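/- arXiv:1803.03349 — 3 statements merged into one kernel-verified Lean document; each statement's English description precedes it below -/
import Mathlib

section
/- For every t > 0 there exists a unique h* > 0 with ρ(h*, t) = 0; moreover ρ(h,t) > 0 for all 0 < h < h* and ρ(h,t) < 0 for all h > h*. -/
noncomputable def phi0 (t : ℝ) : ℝ := 4*t^2+4*t^3+5*t^4+2*t^5+t^6
noncomputable def phi1 (t : ℝ) : ℝ := -2-7*t-4*t^2+t^3-2*t^4-8*t^5-12*t^6-9*t^7-4*t^8-t^9
noncomputable def phi2 (t : ℝ) : ℝ := -8-37*t-76*t^2-101*t^3-109*t^4-102*t^5-77*t^6-43*t^7-16*t^8-3*t^9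
noncomputable def phi3 (t : ℝ) : ℝ := -12-69*t-180*t^2-288*t^3-322*t^4-268*t^5-168*t^6-76*t^7-22*t^8-3*t^9
noncomputable def phi4 (t : ℝ) : ℝ := -8-55*t-168*t^2-302*t^3-356*t^4-288*t^5-160*t^6-58*t^7-12*t^8-t^9
noncomputable def phi5 (t : ℝ) : ℝ := -2-16*t-56*t^2-112*t^3-140*t^4-112*t^5-56*t^6-16*t^7-2*t^8

noncomputable def rho (h t : ℝ) : ℝ :=
  phi0 t + phi1 t * h + phi2 t * h^2 + phi3 t * h^3 + phi4 t * h^4 + phi5 t * h^5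

lemma phi0_pos {t : ℝ} (ht : 0 < t) : 0 < phi0 t := by
  unfold phi0; positivity

lemma phi1_lt {t : ℝ} (ht : 0 < t) : phi1 t < -2 := by
  have h : phi1 t = -2 - (7*t + 3*t^2 + (t - t^2)^2 + t^3 + t^4 + 8*t^5 + 12*t^6 + 9*t^7
      + 4*t^8 + t^9) := by
    unfold phi1; ring
  have : 0 < 7*t + 3*t^2 + (t - t^2)^2 + t^3 + t^4 + 8*t^5 + 12*t^6 + 9*t^7 + 4*t^8 + t^9 := by
    positivity
  linarith

lemma phi2_neg {t : ℝ} (ht : 0 < t) : phi2 t < 0 := by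
  have : 0 < 8+37*t+76*t^2+101*t^3+109*t^4+102*t^5+77*t^6+43*t^7+16*t^8+3*t^9 := by positivity
  unfold phi2; linarith

lemma phi3_neg {t : ℝ} (ht : 0 < t) : phi3 t < 0 := by
  have : 0 < 12+69*t+180*t^2+288*t^3+322*t^4+268*t^5+168*t^6+76*t^7+22*t^8+3*t^9 := by positivity
  unfold phi3; linarith

lemma phi4_neg {t : ℝ} (ht : 0 < t) : phi4 t < 0 := by
  have : 0 < 8+55*t+168*t^2+302*t^3+356*t^4+288*t^5+160*t^6+58*t^7+12*t^8+t^9 := by positivity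
  unfold phi4; linarith

lemma phi5_neg {t : ℝ} (ht : 0 < t) : phi5 t < 0 := by
  have : 0 < 2+16*t+56*t^2+112*t^3+140*t^4+112*t^5+56*t^6+16*t^7+2*t^8 := by positivity
  unfold phi5; linarith

lemma rho_zero (t : ℝ) : rho 0 t = phi0 t := by
  simp [rho]

lemma continuous_rho_left (t : ℝ) : Continuous fun h => rho h t := by
  unfold rho; fun_prop

lemma rho_strictAntiOn {t : ℝ} (ht : 0 < t) : StrictAntiOn (fun h => rho h t) (Set.Ici 0) := by
  intro a ha b _ hab
  have ha : 0 ≤ a := ha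
  have hpow (n : ℕ) : a ^ n ≤ b ^ n := pow_le_pow_left₀ ha hab.le n
  have h1 := mul_lt_mul_of_neg_left hab ((phi1_lt ht).trans (by norm_num))
  have h2 := mul_le_mul_of_nonpos_left (hpow 2) (phi2_neg ht).le
  have h3 := mul_le_mul_of_nonpos_left (hpow 3) (phi3_neg ht).le
  have h4 := mul_le_mul_of_nonpos_left (hpow 4) (phi4_neg ht).le
  have h5 := mul_le_mul_of_nonpos_left (hpow 5) (phi5_neg ht).le
  simp only [rho]
  linarith

lemma rho_phi0_neg {t : ℝ} (ht : 0 < t) : rho (phi0 t) t < 0 := by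
  have h0 := phi0_pos ht
  have h1 := mul_lt_mul_of_pos_right (phi1_lt ht) h0
  have h2 := mul_neg_of_neg_of_pos (phi2_neg ht) (pow_pos h0 2)
  have h3 := mul_neg_of_neg_of_pos (phi3_neg ht) (pow_pos h0 3)
  have h4 := mul_neg_of_neg_of_pos (phi4_neg ht) (pow_pos h0 4)
  have h5 := mul_neg_of_neg_of_pos (phi5_neg ht) (pow_pos h0 5)
  simp only [rho]
  linarith

theorem rho_unique_root (t : ℝ) (ht : 0 < t) :
    ∃ hstar : ℝ, 0 < hstar ∧ rho hstar t = 0 ∧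
      (∀ h : ℝ, 0 < h → rho h t = 0 → h = hstar) ∧
      (∀ h : ℝ, 0 < h → h < hstar → 0 < rho h t) ∧
      (∀ h : ℝ, hstar < h → rho h t < 0) := by
  have hanti := rho_strictAntiOn ht
  obtain ⟨s, ⟨hs, -⟩, hroot⟩ : (0 : ℝ) ∈ (fun h => rho h t) '' Set.Ioo 0 (phi0 t) :=
    intermediate_value_Ioo' (phi0_pos ht).le (continuous_rho_left t).continuousOn
      ⟨rho_phi0_neg ht, (phi0_pos ht).trans_eq (rho_zero t).symm⟩
  have hroot : rho s t = 0 := hroot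
  refine ⟨s, hs, hroot, fun h hh hr => ?_, fun h hh hlt => ?_, fun h hlt => ?_⟩
  · exact hanti.injOn hh.le hs.le (hr.trans hroot.symm)
  · exact hroot.symm.trans_lt (hanti hh.le hs.le hlt)
  · exact (hanti hs.le (hs.trans hlt).le hlt).trans_eq hroot
end

section
/- For every b > 0 such that there exists h > 0 with p(h,b) > 0, the set {h > 0 : p(h,b) = 0} has exactly two elements. (This expresses that each horizontal line strictly inside the semi-cubic hyponormality region meets its boundary in exactly two points.) -/
noncomputable def xi0 (h : ℝ) : ℝ := 2*h^9*(h+1)^4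
noncomputable def xi1 (h : ℝ) : ℝ := h^8*(16*h+7)*(h+1)^3
noncomputable def xi2 (h : ℝ) : ℝ := 4*h^6*(3*h+14*h^2+14*h^3-1)*(h+1)^2
noncomputable def xi3 (h : ℝ) : ℝ := h^5*(h+1)*(3*h+98*h^2+190*h^3+112*h^4-4)
noncomputable def xi4 (h : ℝ) : ℝ := h^4*(2*h+109*h^2+322*h^3+356*h^4+140*h^5-5)
noncomputable def xi5 (h : ℝ) : ℝ := 2*h^3*(h+1)*(5*h+46*h^2+88*h^3+56*h^4-1)
noncomputable def xi6 (h : ℝ) : ℝ := h^2*(h+1)*(13*h+64*h^2+104*h^3+56*h^4-1)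
noncomputable def xi7 (h : ℝ) : ℝ := h^2*(h+1)*(34*h+42*h^2+16*h^3+9)
noncomputable def xi8 (h : ℝ) : ℝ := 2*h*(4*h+h^2+2)*(h+1)^2
noncomputable def xi9 (h : ℝ) : ℝ := (h+1)^3

noncomputable def p (h k : ℝ) : ℝ :=
  -(xi0 h + xi1 h * k + xi2 h * k^2 + xi3 h * k^3 + xi4 h * k^4
    + xi5 h * k^5 + xi6 h * k^6 + xi7 h * k^7 + xi8 h * k^8 + xi9 h * k^9)

/-- For positive reals, a real power with exponent at most `0` or at least `1` is convex. -/
lemma rpow_weighted_add_le {r s t x z : ℝ} (hr : r ≤ 0 ∨ 1 ≤ r) (hs : 0 ≤ s) (ht : 0 ≤ t)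
    (hst : s + t = 1) (hx : 0 < x) (hz : 0 < z) :
    (s * x + t * z) ^ r ≤ s * x ^ r + t * z ^ r := by
  rcases hr with hr | hr
  · calc (s * x + t * z) ^ r ≤ (x ^ s * z ^ t) ^ r :=
          Real.rpow_le_rpow_of_nonpos (by positivity)
            (Real.geom_mean_le_arith_mean2_weighted hs ht hx.le hz.le hst) hr
      _ = (x ^ r) ^ s * (z ^ r) ^ t := by
          rw [Real.mul_rpow (by positivity) (by positivity), ← Real.rpow_mul hx.le,
            ← Real.rpow_mul hz.le, ← Real.rpow_mul hx.le, ← Real.rpow_mul hz.le, mul_comm s,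
            mul_comm t]
      _ ≤ s * x ^ r + t * z ^ r :=
          Real.geom_mean_le_arith_mean2_weighted hs ht (by positivity) (by positivity) hst
  · exact (convexOn_rpow hr).2 hx.le hz.le hs ht hst

/-- A polynomial whose coefficients are nonnegative, then nonpositive strictly between the degrees
`l` and `u`, then nonnegative, becomes convex on the positive reals after division by `x ^ l` and
the change of variable `y = x ^ (u - l)`.  Hence it is negative strictly between two positive
points at which it is nonpositive. -/
lemma sum_mul_pow_neg_of_mem_Ioo {N : ℕ} (a : Fin N → ℝ) {l u : ℕ} (hlu : l < u)
    (hlow : ∀ i : Fin N, (i : ℕ) < l → 0 ≤ a i)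
    (hmid : ∀ i : Fin N, l < (i : ℕ) → (i : ℕ) < u → a i ≤ 0)
    (hhigh : ∀ i : Fin N, u < (i : ℕ) → 0 ≤ a i)
    (m : Fin N) (hum : u < (m : ℕ)) (hm : 0 < a m)
    {x y z : ℝ} (hx : 0 < x) (hxy : x < y) (hyz : y < z)
    (hPx : ∑ i, a i * x ^ (i : ℕ) ≤ 0) (hPz : ∑ i, a i * z ^ (i : ℕ) ≤ 0) :
    ∑ i, a i * y ^ (i : ℕ) < 0 := by
  have hy : 0 < y := hx.trans hxy
  have hz : 0 < z := hy.trans hyz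
  have hn : (0 : ℝ) < (u : ℝ) - l := sub_pos.2 (by exact_mod_cast hlu)
  set n : ℝ := (u : ℝ) - l
  set e : Fin N → ℝ := fun i => ((i : ℕ) - l : ℝ) / n
  have split (w : ℝ) (hw : 0 < w) :
      ∑ i, a i * w ^ (i : ℕ) = w ^ l * ∑ i, a i * (w ^ n) ^ e i := by
    rw [Finset.mul_sum]
    refine Finset.sum_congr rfl fun i _ => ?_
    rw [← Real.rpow_mul hw.le, mul_div_cancel₀ _ hn.ne', Real.rpow_sub hw, Real.rpow_natCast,
      Real.rpow_natCast]
    field_simp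
  rw [split x hx] at hPx
  rw [split z hz] at hPz
  rw [split y hy]
  have hPx' : ∑ i, a i * (x ^ n) ^ e i ≤ 0 := nonpos_of_mul_nonpos_right hPx (by positivity)
  have hPz' : ∑ i, a i * (z ^ n) ^ e i ≤ 0 := nonpos_of_mul_nonpos_right hPz (by positivity)
  refine mul_neg_of_pos_of_neg (by positivity) ?_
  have hX : 0 < x ^ n := by positivity
  have hZ : 0 < z ^ n := by positivity
  have hXY : x ^ n < y ^ n := Real.rpow_lt_rpow hx.le hxy hn
  have hYZ : y ^ n < z ^ n := Real.rpow_lt_rpow hy.le hyz hn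
  generalize x ^ n = X at *
  generalize y ^ n = Y at *
  generalize z ^ n = Z at *
  obtain ⟨s, t, hs, ht, hst, rfl⟩ : ∃ s t : ℝ, 0 < s ∧ 0 < t ∧ s + t = 1 ∧ s * X + t * Z = Y := by
    have : 0 < Z - X := by linarith
    refine ⟨(Z - Y) / (Z - X), (Y - X) / (Z - X), div_pos (by linarith) this,
      div_pos (by linarith) this, ?_, ?_⟩ <;> field_simp <;> ring
  have strict : (s * X + t * Z) ^ e m < s * X ^ e m + t * Z ^ e m := by
    refine (strictConvexOn_rpow ?_).2 hX.le hZ.le (hXY.trans hYZ).ne hs ht hst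
    rw [one_lt_div hn]
    have : (u : ℝ) < (m : ℕ) := by exact_mod_cast hum
    linarith
  have weak (i : Fin N) :
      a i * (s * X + t * Z) ^ e i ≤ a i * (s * X ^ e i + t * Z ^ e i) := by
    have convex (h : e i ≤ 0 ∨ 1 ≤ e i) := rpow_weighted_add_le h hs.le ht.le hst hX hZ
    have concave (h0 : 0 ≤ e i) (h1 : e i ≤ 1) :
        s * X ^ e i + t * Z ^ e i ≤ (s * X + t * Z) ^ e i :=
      (Real.concaveOn_rpow h0 h1).2 hX.le hZ.le hs.le ht.le hst
    have below (h : (i : ℕ) ≤ l) : e i ≤ 0 := by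
      have : ((i : ℕ) : ℝ) ≤ l := by exact_mod_cast h
      exact div_nonpos_of_nonpos_of_nonneg (by linarith) hn.le
    have above (h : u ≤ (i : ℕ)) : 1 ≤ e i := by
      have : (u : ℝ) ≤ (i : ℕ) := by exact_mod_cast h
      rw [one_le_div hn]
      linarith
    have nonneg (h : l ≤ (i : ℕ)) : 0 ≤ e i := by
      have : (l : ℝ) ≤ (i : ℕ) := by exact_mod_cast h
      exact div_nonneg (by linarith) hn.le
    have le_one (h : (i : ℕ) ≤ u) : e i ≤ 1 := by
      have : ((i : ℕ) : ℝ) ≤ u := by exact_mod_cast h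
      rw [div_le_one hn]
      linarith
    rcases lt_trichotomy (i : ℕ) l with hi | hi | hi
    · exact mul_le_mul_of_nonneg_left (convex (.inl (below hi.le))) (hlow i hi)
    · rw [le_antisymm (convex (.inl (below hi.le))) (concave (nonneg hi.ge) (le_one (by omega)))]
    rcases lt_trichotomy (i : ℕ) u with hi' | hi' | hi'
    · exact mul_le_mul_of_nonpos_left (concave (nonneg hi.le) (le_one hi'.le)) (hmid i hi hi')
    · rw [le_antisymm (convex (.inr (above hi'.ge))) (concave (nonneg hi.le) (le_one hi'.le))]
    · exact mul_le_mul_of_nonneg_left (convex (.inr (above hi'.le))) (hhigh i hi')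
  calc ∑ i, a i * (s * X + t * Z) ^ e i
      < ∑ i, a i * (s * X ^ e i + t * Z ^ e i) :=
        Finset.sum_lt_sum (fun i _ => weak i)
          ⟨m, Finset.mem_univ m, mul_lt_mul_of_pos_left strict hm⟩
    _ = s * ∑ i, a i * X ^ e i + t * ∑ i, a i * Z ^ e i := by
        rw [Finset.mul_sum, Finset.mul_sum, ← Finset.sum_add_distrib]
        exact Finset.sum_congr rfl fun i _ => by ring
    _ ≤ 0 := by nlinarith

/-- The coefficients of `-p h k` as a polynomial in `h`. -/
noncomputable def hCoeff (k : ℝ) : Fin 14 → ℝ :=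
  ![
    k ^ 9,
    4 * k ^ 8 + 3 * k ^ 9,
    -k ^ 6 + 9 * k ^ 7 + 16 * k ^ 8 + 3 * k ^ 9,
    -2 * k ^ 5 + 12 * k ^ 6 + 43 * k ^ 7 + 22 * k ^ 8 + k ^ 9,
    -5 * k ^ 4 + 8 * k ^ 5 + 77 * k ^ 6 + 76 * k ^ 7 + 12 * k ^ 8,
    -4 * k ^ 3 + 2 * k ^ 4 + 102 * k ^ 5 + 168 * k ^ 6 + 58 * k ^ 7 + 2 * k ^ 8,
    -4 * k ^ 2 - k ^ 3 + 109 * k ^ 4 + 268 * k ^ 5 + 160 * k ^ 6 + 16 * k ^ 7,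
    4 * k ^ 2 + 101 * k ^ 3 + 322 * k ^ 4 + 288 * k ^ 5 + 56 * k ^ 6,
    7 * k + 76 * k ^ 2 + 288 * k ^ 3 + 356 * k ^ 4 + 112 * k ^ 5,
    2 + 37 * k + 180 * k ^ 2 + 302 * k ^ 3 + 140 * k ^ 4,
    8 + 69 * k + 168 * k ^ 2 + 112 * k ^ 3,
    12 + 55 * k + 56 * k ^ 2,
    8 + 16 * k,
    2]

lemma sum_hCoeff_mul_pow (h k : ℝ) : ∑ i, hCoeff k i * h ^ (i : ℕ) = -p h k := by
  simp only [Fin.sum_univ_succ, hCoeff, p, xi0, xi1, xi2, xi3, xi4, xi5, xi6, xi7, xi8, xi9]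
  simp
  ring

lemma hCoeff_nonneg {k : ℝ} (hk : 0 < k) (i : Fin 14) (hi : (i : ℕ) < 2 ∨ 6 < (i : ℕ)) :
    0 ≤ hCoeff k i := by
  fin_cases i <;> simp at hi <;> simp [hCoeff] <;> positivity

/-- Along a horizontal line the coefficients of `-p` change sign at most twice. -/
lemma exists_hCoeff_sign_pattern {k : ℝ} (hk : 0 < k) :
    ∃ l u : ℕ, l < u ∧ u ≤ 6 ∧ (∀ i : Fin 14, (i : ℕ) < l → 0 ≤ hCoeff k i) ∧
      (∀ i : Fin 14, l < (i : ℕ) → (i : ℕ) < u → hCoeff k i ≤ 0) ∧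
      (∀ i : Fin 14, u < (i : ℕ) → 0 ≤ hCoeff k i) := by
  have c2 (h : 1 / 10 ≤ k) : 0 ≤ hCoeff k 2 := by
    have : hCoeff k 2 = k ^ 6 * (-1 + 9 * k + 16 * k ^ 2 + 3 * k ^ 3) := by simp [hCoeff]; ring
    rw [this]
    have : 0 < k ^ 3 := by positivity
    exact mul_nonneg (by positivity) (by nlinarith)
  have c3 (h : k ≤ 1 / 10) : hCoeff k 3 ≤ 0 := by
    have : hCoeff k 3 = k ^ 5 * (-2 + 12 * k + 43 * k ^ 2 + 22 * k ^ 3 + k ^ 4) := by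
      simp [hCoeff]; ring
    rw [this]
    have h2 := pow_le_pow_left₀ hk.le h 2
    have h3 := pow_le_pow_left₀ hk.le h 3
    have h4 := pow_le_pow_left₀ hk.le h 4
    exact mul_nonpos_of_nonneg_of_nonpos (by positivity) (by linarith)
  have c3' (h : 33 / 200 ≤ k) : 0 ≤ hCoeff k 3 := by
    have : hCoeff k 3 = k ^ 5 * (-2 + 12 * k + 43 * k ^ 2 + 22 * k ^ 3 + k ^ 4) := by
      simp [hCoeff]; ring
    rw [this]
    have h2 := pow_le_pow_left₀ (by norm_num) h 2
    have h3 : 0 < k ^ 3 := by positivity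
    have h4 : 0 < k ^ 4 := by positivity
    exact mul_nonneg (by positivity) (by linarith)
  have c4 (h : k ≤ 33 / 200) : hCoeff k 4 ≤ 0 := by
    have : hCoeff k 4 = k ^ 4 * (-5 + 8 * k + 77 * k ^ 2 + 76 * k ^ 3 + 12 * k ^ 4) := by
      simp [hCoeff]; ring
    rw [this]
    have h2 := pow_le_pow_left₀ hk.le h 2
    have h3 := pow_le_pow_left₀ hk.le h 3
    have h4 := pow_le_pow_left₀ hk.le h 4
    exact mul_nonpos_of_nonneg_of_nonpos (by positivity) (by linarith)
  have c5 (h : k ≤ 33 / 200) : hCoeff k 5 ≤ 0 := by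
    have : hCoeff k 5 = k ^ 3 * (-4 + 2 * k + 102 * k ^ 2 + 168 * k ^ 3 + 58 * k ^ 4 + 2 * k ^ 5) := by
      simp [hCoeff]; ring
    rw [this]
    have h2 := pow_le_pow_left₀ hk.le h 2
    have h3 := pow_le_pow_left₀ hk.le h 3
    have h4 := pow_le_pow_left₀ hk.le h 4
    have h5 := pow_le_pow_left₀ hk.le h 5
    exact mul_nonpos_of_nonneg_of_nonpos (by positivity) (by linarith)
  have c6 (h : 33 / 200 ≤ k) : 0 ≤ hCoeff k 6 := by
    have : hCoeff k 6 = k ^ 2 * (-4 - k + 109 * k ^ 2 + 268 * k ^ 3 + 160 * k ^ 4 + 16 * k ^ 5) := by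
      simp [hCoeff]; ring
    rw [this]
    have h2 := mul_le_mul_of_nonneg_left h hk.le
    have h3 := pow_le_pow_left₀ (by norm_num) h 3
    have h4 : 0 < k ^ 4 := by positivity
    have h5 : 0 < k ^ 5 := by positivity
    exact mul_nonneg (by positivity) (by nlinarith)
  have low (i : Fin 14) (hi : (i : ℕ) < 2) := hCoeff_nonneg hk i (.inl hi)
  have high (i : Fin 14) (hi : 6 < (i : ℕ)) := hCoeff_nonneg hk i (.inr hi)
  rcases le_total k (1 / 10) with h | h
  · refine ⟨2, 6, by norm_num, le_rfl, low, fun i h1 h2 => ?_, high⟩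
    obtain rfl | rfl | rfl : i = 3 ∨ i = 4 ∨ i = 5 := by omega
    exacts [c3 h, c4 (by linarith), c5 (by linarith)]
  rcases le_total k (33 / 200) with h' | h'
  · refine ⟨3, 6, by norm_num, le_rfl, fun i h1 => ?_, fun i h1 h2 => ?_, high⟩
    · obtain hi | rfl : (i : ℕ) < 2 ∨ i = 2 := by omega
      exacts [low i hi, c2 h]
    · obtain rfl | rfl : i = 4 ∨ i = 5 := by omega
      exacts [c4 h', c5 h']
  · refine ⟨4, 5, by norm_num, by norm_num, fun i h1 => ?_, fun i h1 h2 => by omega,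
      fun i h1 => ?_⟩
    · obtain hi | rfl | rfl : (i : ℕ) < 2 ∨ i = 2 ∨ i = 3 := by omega
      exacts [low i hi, c2 h, c3' h']
    · obtain rfl | hi : i = 6 ∨ 6 < (i : ℕ) := by omega
      exacts [c6 h', high i hi]

lemma p_pos_of_mem_Ioo {k x y z : ℝ} (hk : 0 < k) (hx : 0 < x) (hxy : x < y) (hyz : y < z)
    (hpx : p x k = 0) (hpz : p z k = 0) : 0 < p y k := by
  obtain ⟨l, u, hlu, hu, hlow, hmid, hhigh⟩ := exists_hCoeff_sign_pattern hk
  have := sum_mul_pow_neg_of_mem_Ioo (hCoeff k) hlu hlow hmid hhigh 13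
    (show u < 13 by omega) (by simp [hCoeff]) hx hxy hyz
    (by rw [sum_hCoeff_mul_pow, hpx, neg_zero]) (by rw [sum_hCoeff_mul_pow, hpz, neg_zero])
  rw [sum_hCoeff_mul_pow] at this
  linarith

lemma p_neg_of_one_le {h k : ℝ} (hk : 0 < k) (hh : 1 ≤ h) : p h k < 0 := by
  obtain ⟨g, hg, rfl⟩ : ∃ g : ℝ, 0 ≤ g ∧ h = 1 + g := ⟨h - 1, by linarith, by ring⟩
  unfold p xi0 xi1 xi2 xi3 xi4 xi5 xi6 xi7 xi8 xi9
  rw [neg_lt_zero]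
  ring_nf
  positivity

theorem horizontal_line_meets_boundary_twice (b : ℝ) (hb : 0 < b)
    (hint : ∃ h : ℝ, 0 < h ∧ 0 < p h b) :
    {h : ℝ | 0 < h ∧ p h b = 0}.encard = 2 := by
  obtain ⟨m, hm, hpm⟩ := hint
  have cont : Continuous fun h => p h b := by
    unfold p xi0 xi1 xi2 xi3 xi4 xi5 xi6 xi7 xi8 xi9
    fun_prop
  have hp0 : p 0 b < 0 := by
    simp [p, xi0, xi1, xi2, xi3, xi4, xi5, xi6, xi7, xi8, xi9, hb]
  have hp1 : p (m + 1) b < 0 := p_neg_of_one_le hb (by linarith)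
  obtain ⟨x, ⟨hx0, hxm⟩, hpx⟩ :=
    intermediate_value_Ioo hm.le cont.continuousOn ⟨hp0, hpm⟩
  obtain ⟨z, ⟨hmz, -⟩, hpz⟩ :=
    intermediate_value_Ioo' (by linarith : m ≤ m + 1) cont.continuousOn ⟨hp1, hpm⟩
  have hxz : x < z := hxm.trans hmz
  have hset : {h : ℝ | 0 < h ∧ p h b = 0} = {x, z} := by
    ext w
    constructor
    · rintro ⟨hw, hpw⟩
      by_contra hne
      obtain ⟨hwx, hwz⟩ : w ≠ x ∧ w ≠ z := by simpa using hne
      rcases lt_or_gt_of_ne hwx with h | h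
      · exact (p_pos_of_mem_Ioo hb hw h hxz hpw hpz).ne' hpx
      rcases lt_or_gt_of_ne hwz with h' | h'
      · exact (p_pos_of_mem_Ioo hb hx0 h h' hpx hpz).ne' hpw
      · exact (p_pos_of_mem_Ioo hb hx0 hxz h' hpx hpw).ne' hpz
    · rintro (rfl | rfl)
      exacts [⟨hx0, hpx⟩, ⟨hx0.trans hxz, hpz⟩]
  rw [hset, Set.encard_pair hxz.ne]
end

section
/- Define h_M = sSup {h > 0 : ∃ k > 0, p(h,k) ≥ 0}. Then h_M = sSup {h > 0 : ∃ t > 0, ρ(h,t) = 0 and Q(h,t) = 0}, where Q(h,t) = (∂ρ/∂t)(h,t) = ∑_{i=0}^{5} φ_i'(t) h^i. -/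
noncomputable def Q (h t : ℝ) : ℝ :=
  deriv phi0 t + deriv phi1 t * h + deriv phi2 t * h^2 + deriv phi3 t * h^3
    + deriv phi4 t * h^4 + deriv phi5 t * h^5

theorem p_mul_eq (h t : ℝ) : p h (h * t) = h ^ 8 * rho h t := by
  simp only [p, rho, xi0, xi1, xi2, xi3, xi4, xi5, xi6, xi7, xi8, xi9,
    phi0, phi1, phi2, phi3, phi4, phi5]
  ring

theorem exists_p_nonneg_iff {h : ℝ} (hh : 0 < h) :
    (∃ k : ℝ, 0 < k ∧ 0 ≤ p h k) ↔ ∃ t : ℝ, 0 < t ∧ 0 ≤ rho h t := by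
  have h8 : 0 < h ^ 8 := by positivity
  constructor
  · rintro ⟨k, hk, hp⟩
    refine ⟨k / h, by positivity, ?_⟩
    rw [← mul_div_cancel₀ k hh.ne', p_mul_eq] at hp
    exact nonneg_of_mul_nonneg_right hp h8
  · rintro ⟨t, ht, hr⟩
    exact ⟨h * t, by positivity, by rw [p_mul_eq]; positivity⟩

theorem continuous_rho : Continuous fun x : ℝ × ℝ => rho x.1 x.2 := by
  unfold rho phi0 phi1 phi2 phi3 phi4 phi5
  fun_prop

theorem hasDerivAt_rho (h t : ℝ) : HasDerivAt (rho h) (Q h t) t := by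
  have d0 : DifferentiableAt ℝ phi0 t := by unfold phi0; fun_prop
  have d1 : DifferentiableAt ℝ phi1 t := by unfold phi1; fun_prop
  have d2 : DifferentiableAt ℝ phi2 t := by unfold phi2; fun_prop
  have d3 : DifferentiableAt ℝ phi3 t := by unfold phi3; fun_prop
  have d4 : DifferentiableAt ℝ phi4 t := by unfold phi4; fun_prop
  have d5 : DifferentiableAt ℝ phi5 t := by unfold phi5; fun_prop
  exact ((((d0.hasDerivAt.add (d1.hasDerivAt.mul_const h)).add
    (d2.hasDerivAt.mul_const (h ^ 2))).add (d3.hasDerivAt.mul_const (h ^ 3))).add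
    (d4.hasDerivAt.mul_const (h ^ 4))).add (d5.hasDerivAt.mul_const (h ^ 5))

theorem rho_le {h t : ℝ} (hh : 0 < h) (ht : 0 ≤ t) : rho h t ≤ phi0 t + phi1 t * h := by
  have e2 : 0 ≤ -phi2 t * h ^ 2 := mul_nonneg (by unfold phi2; ring_nf; positivity) (by positivity)
  have e3 : 0 ≤ -phi3 t * h ^ 3 := mul_nonneg (by unfold phi3; ring_nf; positivity) (by positivity)
  have e4 : 0 ≤ -phi4 t * h ^ 4 := mul_nonneg (by unfold phi4; ring_nf; positivity) (by positivity)
  have e5 : 0 ≤ -phi5 t * h ^ 5 := mul_nonneg (by unfold phi5; ring_nf; positivity) (by positivity)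
  unfold rho
  linarith

theorem phi1_neg {t : ℝ} (ht : 0 ≤ t) : phi1 t < 0 := by
  have h1 : 0 ≤ t ^ 2 * (t - 1) ^ 2 := by positivity
  have h2 : 0 ≤ 3 * t ^ 2 + t ^ 4 + 7 * t + 8 * t ^ 5 + 12 * t ^ 6 + 9 * t ^ 7 + 4 * t ^ 8
    + t ^ 9 + t ^ 3 := by positivity
  unfold phi1
  linarith

theorem lt_two_of_rho_nonneg {h t : ℝ} (hh : 0 < h) (ht : 0 ≤ t) (hr : 0 ≤ rho h t) :
    h < 2 := by
  by_contra! h2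
  have h3 := mul_le_mul_of_nonpos_left h2 (phi1_neg ht).le
  have h4 := rho_le hh ht
  have h5 : 0 ≤ t ^ 2 * (t - 1) ^ 2 := by positivity
  unfold phi0 phi1 at *
  nlinarith [pow_nonneg ht 2, pow_nonneg ht 3, pow_nonneg ht 4, pow_nonneg ht 5, pow_nonneg ht 6,
    pow_nonneg ht 7, pow_nonneg ht 8, pow_nonneg ht 9]

theorem lt_ten_of_rho_nonneg {h t : ℝ} (hh : 1 / 50 ≤ h) (ht : 0 ≤ t) (hr : 0 ≤ rho h t) :
    t < 10 := by
  by_contra! h2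
  have h3 := mul_le_mul_of_nonpos_left hh (phi1_neg ht).le
  have h4 := rho_le (h := h) (by linarith) ht
  obtain ⟨s, hs, rfl⟩ : ∃ s : ℝ, 0 ≤ s ∧ t = 10 + s := ⟨t - 10, by linarith, by ring⟩
  have h5 : 0 < -(phi0 (10 + s) + phi1 (10 + s) * (1 / 50)) := by
    unfold phi0 phi1
    ring_nf
    positivity
  linarith

theorem pos_of_rho_nonneg {h t : ℝ} (hh : 0 < h) (ht : 0 ≤ t) (hr : 0 ≤ rho h t) : 0 < t := by
  rcases ht.eq_or_lt with rfl | ht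
  · have := rho_le hh le_rfl
    norm_num [phi0, phi1] at this
    linarith
  · exact ht

theorem exists_isGreatest_rho_nonneg :
    ∃ h, IsGreatest {h : ℝ | 0 < h ∧ ∃ t : ℝ, 0 < t ∧ 0 ≤ rho h t} h := by
  let K : Set (ℝ × ℝ) := (Set.Icc (1 / 50) 2 ×ˢ Set.Icc 0 10) ∩ {x | 0 ≤ rho x.1 x.2}
  have hK : IsCompact K :=
    (isCompact_Icc.prod isCompact_Icc).inter_right (isClosed_le continuous_const continuous_rho)
  have hne : K.Nonempty :=
    ⟨(1 / 50, 1), by norm_num [K, rho, phi0, phi1, phi2, phi3, phi4, phi5]⟩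
  obtain ⟨⟨h, t⟩, ⟨⟨⟨h1, -⟩, ⟨ht, -⟩⟩, hr⟩, hmax⟩ := hK.exists_isMaxOn hne continuous_fst.continuousOn
  simp only at h1 ht
  have hpos : 0 < h := by linarith
  refine ⟨h, ⟨hpos, t, pos_of_rho_nonneg hpos ht hr, hr⟩, ?_⟩
  rintro h' ⟨hh', t', ht', hr'⟩
  rcases le_or_gt (1 / 50) h' with hl | hl
  · exact hmax (a := (h', t')) ⟨⟨⟨hl, (lt_two_of_rho_nonneg hh' ht'.le hr').le⟩,
      ⟨ht'.le, (lt_ten_of_rho_nonneg hl ht'.le hr').le⟩⟩, hr'⟩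
  · linarith

theorem rho_nonpos_of_isGreatest {h : ℝ}
    (hg : IsGreatest {h : ℝ | 0 < h ∧ ∃ t : ℝ, 0 < t ∧ 0 ≤ rho h t} h) {t : ℝ} (ht : 0 < t) :
    rho h t ≤ 0 := by
  by_contra! hr
  have hc : Continuous fun x => rho x t := by
    unfold rho
    fun_prop
  obtain ⟨x, hx, hr'⟩ : ∃ x, h < x ∧ 0 < rho x t :=
    ((eventually_mem_nhdsWithin (s := Set.Ioi h)).and
      ((hc.tendsto h).eventually_const_lt hr |>.filter_mono nhdsWithin_le_nhds)).exists
  have hle : x ≤ h := hg.2 ⟨hg.1.1.trans hx, t, ht, hr'.le⟩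
  exact hx.not_ge hle

theorem isGreatest_of_isGreatest_rho_nonneg {h : ℝ}
    (hg : IsGreatest {h : ℝ | 0 < h ∧ ∃ t : ℝ, 0 < t ∧ 0 ≤ rho h t} h) :
    IsGreatest {h : ℝ | 0 < h ∧ ∃ t : ℝ, 0 < t ∧ rho h t = 0 ∧ Q h t = 0} h := by
  constructor
  · obtain ⟨hh, t, ht, hr⟩ := hg.1
    have h0 : rho h t = 0 := (rho_nonpos_of_isGreatest hg ht).antisymm hr
    have hloc : IsLocalMax (rho h) t := by
      filter_upwards [lt_mem_nhds ht] with s hs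
      rw [h0]
      exact rho_nonpos_of_isGreatest hg hs
    exact ⟨hh, t, ht, h0, hloc.hasDerivAt_eq_zero (hasDerivAt_rho h t)⟩
  · rintro x ⟨hx, t, ht, hr, -⟩
    exact hg.2 ⟨hx, t, ht, hr.ge⟩

theorem hM_characterization :
    sSup {h : ℝ | 0 < h ∧ ∃ k : ℝ, 0 < k ∧ 0 ≤ p h k}
      = sSup {h : ℝ | 0 < h ∧ ∃ t : ℝ, 0 < t ∧ rho h t = 0 ∧ Q h t = 0} := by
  obtain ⟨h, hg⟩ := exists_isGreatest_rho_nonneg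
  have hset : {h : ℝ | 0 < h ∧ ∃ k : ℝ, 0 < k ∧ 0 ≤ p h k}
      = {h : ℝ | 0 < h ∧ ∃ t : ℝ, 0 < t ∧ 0 ≤ rho h t} := by
    ext x
    exact and_congr_right exists_p_nonneg_iff
  rw [hset, hg.csSup_eq, (isGreatest_of_isGreatest_rho_nonneg hg).csSup_eq]
end
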